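/- Assume the Case (A) setup and let v = (a3·u4 + u3·a4, a3·u4 + u3·a4, a4(u1 + u2), a3(u1 + u2)). Then for every integer w > 0 such that the four entries of n + w·v have greatest common divisor 1, the toric ideal I(n + w·v) equals the ideal of K[x1,x2,x3,x4] generated by x1^{a1+w} − x2^{a2+w}, f2 and f3; in particular it is a complete intersection. -/

import Mathlib

open MvPolynomial

/-- The toric ideal of the monomial curve `(t^{n 0}, t^{n 1}, t^{n 2}, t^{n 3})`:
the kernel of the `K`-algebra map `K[x₁,x₂,x₃,x₄] → K[t]`, `xᵢ ↦ t^{n i}`. -/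
noncomputable def toricIdeal (K : Type*) [Field K] (n : Fin 4 → ℕ) :
    Ideal (MvPolynomial (Fin 4) K) :=
  RingHom.ker (aeval (fun i => (Polynomial.X : Polynomial K) ^ n i) :
    MvPolynomial (Fin 4) K →ₐ[K] Polynomial K)

/-- In a commutative monoid with `x ^ a = y ^ b`, where `a` and `b` are coprime, the monomial
`x ^ i * y ^ j` depends only on its weight `b * i + a * j`. -/
theorem pow_mul_pow_eq_of_weight_eq {M : Type*} [CommMonoid M] {x y : M} {a b : ℕ}
    (ha : 0 < a) (hab : a.Coprime b) (hxy : x ^ a = y ^ b) {i j i' j' : ℕ}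
    (h : b * i + a * j = b * i' + a * j') : x ^ i * y ^ j = x ^ i' * y ^ j' := by
  wlog hi : i' ≤ i generalizing i j i' j'
  · exact (this h.symm (by omega)).symm
  obtain ⟨d, rfl⟩ := Nat.exists_eq_add_of_le hi
  obtain ⟨m, rfl⟩ : a ∣ d := hab.dvd_of_dvd_mul_left
    ((Nat.dvd_add_left (Dvd.intro j rfl)).1 ⟨j', by linarith⟩)
  obtain rfl : j' = j + b * m := Nat.eq_of_mul_eq_mul_left ha (by linarith)
  rw [pow_add, pow_add, pow_mul, pow_mul, hxy, mul_assoc, mul_comm (y ^ j)]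

/-- Gluing: if the relations of two coprime pairs are joined by the relation
`x ^ u1 * y ^ u2 = z ^ u3 * t ^ u4`, a monomial in four elements depends only on its weight. -/
theorem monomial_eq_of_glued_weight_eq {M : Type*} [CommMonoid M] {x y z t : M}
    {a b c d u1 u2 u3 u4 p q : ℕ} (ha : 0 < a) (hc : 0 < c) (hq : 0 < q)
    (hab : a.Coprime b) (hcd : c.Coprime d) (hpq : p.Coprime q)
    (hp_eq : p = c * u4 + u3 * d) (hq_eq : q = a * u2 + u1 * b)
    (hxy : x ^ a = y ^ b) (hzt : z ^ c = t ^ d)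
    (hglue : x ^ u1 * y ^ u2 = z ^ u3 * t ^ u4) {i j k l i' j' k' l' : ℕ}
    (h : b * p * i + a * p * j + d * q * k + c * q * l =
      b * p * i' + a * p * j' + d * q * k' + c * q * l') :
    x ^ i * y ^ j * z ^ k * t ^ l = x ^ i' * y ^ j' * z ^ k' * t ^ l' := by
  wlog hs : b * i' + a * j' ≤ b * i + a * j generalizing i j k l i' j' k' l'
  · exact (this h.symm (by omega)).symm
  obtain ⟨e, he⟩ := Nat.exists_eq_add_of_le hs
  have hw : p * e + q * (d * k + c * l) = q * (d * k' + c * l') := by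
    have : p * (b * i + a * j) = p * (b * i' + a * j' + e) := congrArg (p * ·) he
    linarith
  obtain ⟨m, rfl⟩ : q ∣ e := hpq.symm.dvd_of_dvd_mul_left
    ((Nat.dvd_add_left (Dvd.intro _ rfl)).1 ⟨_, hw⟩)
  have hxy' : x ^ i * y ^ j = x ^ (i' + u1 * m) * y ^ (j' + u2 * m) :=
    pow_mul_pow_eq_of_weight_eq ha hab hxy (by rw [he, hq_eq]; ring)
  have hzt' : z ^ k' * t ^ l' = z ^ (k + u3 * m) * t ^ (l + u4 * m) := by
    refine pow_mul_pow_eq_of_weight_eq hc hcd hzt ?_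
    refine Nat.eq_of_mul_eq_mul_left hq ?_
    rw [← hw, hp_eq]
    ring
  calc x ^ i * y ^ j * z ^ k * t ^ l
      = x ^ i' * y ^ j' * (x ^ u1 * y ^ u2) ^ m * (z ^ k * t ^ l) := by
        rw [mul_assoc _ (z ^ k) (t ^ l), hxy', pow_add, pow_add, pow_mul, pow_mul, mul_pow,
          mul_mul_mul_comm (x ^ i')]
    _ = x ^ i' * y ^ j' * (z ^ k' * t ^ l') := by
        rw [hglue, hzt', pow_add, pow_add, pow_mul, pow_mul, mul_pow,
          mul_mul_mul_comm (z ^ k), mul_assoc, mul_comm (_ * _) (z ^ k * t ^ l)]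
    _ = x ^ i' * y ^ j' * z ^ k' * t ^ l' := (mul_assoc _ _ _).symm

theorem aeval_X_pow_monomial {K : Type*} [Field K] (n : Fin 4 → ℕ) (s : Fin 4 →₀ ℕ) :
    aeval (fun i => (Polynomial.X : Polynomial K) ^ n i) (monomial s (1 : K)) =
      Polynomial.monomial (∑ i, n i * s i) 1 := by
  rw [aeval_monomial, map_one, one_mul, Finsupp.prod_fintype _ _ (fun _ => pow_zero _),
    ← Polynomial.X_pow_eq_monomial, ← Finset.prod_pow_eq_pow_sum]
  exact Finset.prod_congr rfl fun i _ => (pow_mul _ _ _).symm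

/-- An ideal contains the toric ideal as soon as monomials of equal weight agree modulo it. -/
theorem toricIdeal_le {K : Type*} [Field K] {n : Fin 4 → ℕ} {I : Ideal (MvPolynomial (Fin 4) K)}
    (hI : ∀ s s' : Fin 4 →₀ ℕ, ∑ i, n i * s i = ∑ i, n i * s' i →
      Ideal.Quotient.mk I (monomial s 1) = Ideal.Quotient.mk I (monomial s' 1)) :
    toricIdeal K n ≤ I := by
  let weight : (Fin 4 →₀ ℕ) → ℕ := fun s => ∑ i, n i * s i
  let ψ : Polynomial K →ₗ[K] MvPolynomial (Fin 4) K ⧸ I :=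
    (Polynomial.basisMonomials K).constr K fun d =>
      Ideal.Quotient.mk I (monomial (Function.invFun weight d) 1)
  have hψ : ψ ∘ₗ (aeval fun i => (Polynomial.X : Polynomial K) ^ n i).toLinearMap =
      (Ideal.Quotient.mkₐ K I).toLinearMap := by
    refine (basisMonomials (Fin 4) K).ext fun s => ?_
    have hs : ψ (Polynomial.monomial (weight s) 1) =
        Ideal.Quotient.mk I (monomial (Function.invFun weight (weight s)) 1) := by
      simpa using (Polynomial.basisMonomials K).constr_basis K
        (fun d => Ideal.Quotient.mk I (monomial (Function.invFun weight d) 1)) (weight s)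
    simp only [coe_basisMonomials, LinearMap.comp_apply, AlgHom.toLinearMap_apply,
      aeval_X_pow_monomial, Ideal.Quotient.mkₐ_eq_mk]
    exact hs.trans (hI _ _ (Function.invFun_eq (f := weight) ⟨s, rfl⟩))
  intro f hf
  have hf' : aeval (fun i => (Polynomial.X : Polynomial K) ^ n i) f = 0 := hf
  have h := LinearMap.congr_fun hψ f
  simp only [LinearMap.comp_apply, AlgHom.toLinearMap_apply, hf', map_zero,
    Ideal.Quotient.mkₐ_eq_mk] at h
  exact Ideal.Quotient.eq_zero_iff_mem.1 h.symm

theorem toricIdeal_glued_eq_span (K : Type*) [Field K] {a b c d u1 u2 u3 u4 p q : ℕ}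
    (ha : 0 < a) (hc : 0 < c) (hq : 0 < q)
    (hp_eq : p = c * u4 + u3 * d) (hq_eq : q = a * u2 + u1 * b)
    (hgcd : Nat.gcd (Nat.gcd (Nat.gcd (b * p) (a * p)) (d * q)) (c * q) = 1) :
    toricIdeal K ![b * p, a * p, d * q, c * q] =
      Ideal.span {(X 0 : MvPolynomial (Fin 4) K) ^ a - X 1 ^ b, X 2 ^ c - X 3 ^ d,
        X 0 ^ u1 * X 1 ^ u2 - X 2 ^ u3 * X 3 ^ u4} := by
  have eq_one_of_dvd : ∀ g, g ∣ b * p → g ∣ a * p → g ∣ d * q → g ∣ c * q → g = 1 :=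
    fun g h1 h2 h3 h4 => Nat.dvd_one.1
      (hgcd ▸ Nat.dvd_gcd (Nat.dvd_gcd (Nat.dvd_gcd h1 h2) h3) h4)
  have hab : a.Coprime b := by
    have h1 := Nat.gcd_dvd_left a b
    have h2 := Nat.gcd_dvd_right a b
    have h3 : a.gcd b ∣ q := hq_eq ▸ dvd_add (h1.mul_right _) (h2.mul_left _)
    exact eq_one_of_dvd _ (h2.mul_right _) (h1.mul_right _) (h3.mul_left _) (h3.mul_left _)
  have hcd : c.Coprime d := by
    have h1 := Nat.gcd_dvd_left c d
    have h2 := Nat.gcd_dvd_right c d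
    have h3 : c.gcd d ∣ p := hp_eq ▸ dvd_add (h1.mul_right _) (h2.mul_left _)
    exact eq_one_of_dvd _ (h3.mul_left _) (h3.mul_left _) (h2.mul_right _) (h1.mul_right _)
  have hpq : p.Coprime q := by
    have h1 := Nat.gcd_dvd_left p q
    have h2 := Nat.gcd_dvd_right p q
    exact eq_one_of_dvd _ (h1.mul_left _) (h1.mul_left _) (h2.mul_left _) (h2.mul_left _)
  apply le_antisymm
  · refine toricIdeal_le fun s s' h => ?_
    set I := Ideal.span {(X 0 : MvPolynomial (Fin 4) K) ^ a - X 1 ^ b, X 2 ^ c - X 3 ^ d,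
        X 0 ^ u1 * X 1 ^ u2 - X 2 ^ u3 * X 3 ^ u4}
    have hxy := Ideal.Quotient.eq.2
      (Ideal.subset_span (by simp) : (X 0 : MvPolynomial (Fin 4) K) ^ a - X 1 ^ b ∈ I)
    have hzt := Ideal.Quotient.eq.2
      (Ideal.subset_span (by simp) : (X 2 : MvPolynomial (Fin 4) K) ^ c - X 3 ^ d ∈ I)
    have hglue := Ideal.Quotient.eq.2
      (Ideal.subset_span (by simp) : (X 0 : MvPolynomial (Fin 4) K) ^ u1 * X 1 ^ u2 -
        X 2 ^ u3 * X 3 ^ u4 ∈ I)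
    simp only [map_mul, map_pow] at hxy hzt hglue
    simp only [Fin.sum_univ_four] at h
    simp only [monomial_eq, Finsupp.prod_fintype _ _ (fun _ => pow_zero _), Fin.prod_univ_four,
      map_mul, map_pow, map_one, one_mul]
    exact monomial_eq_of_glued_weight_eq ha hc hq hab hcd hpq hp_eq hq_eq hxy hzt hglue h
  · rw [Ideal.span_le]
    rintro f (rfl | rfl | rfl) <;> rw [SetLike.mem_coe, toricIdeal, RingHom.mem_ker] <;>
      simp only [map_sub, map_mul, map_pow, aeval_X, ← pow_mul, ← pow_add, sub_eq_zero]
    · exact congrArg _ (show b * p * a = a * p * b by ring)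
    · exact congrArg _ (show d * q * c = c * q * d by ring)
    · exact congrArg _ (show b * p * u1 + a * p * u2 = d * q * u3 + c * q * u4 by
        rw [hp_eq, hq_eq]; ring)

theorem stmt5 (K : Type*) [Field K] (a1 a2 a3 a4 u1 u2 u3 u4 : ℕ)
    (ha1 : 0 < a1) (ha2 : 0 < a2) (ha3 : 0 < a3) (ha4 : 0 < a4)
    (hu12 : ¬(u1 = 0 ∧ u2 = 0)) (hu34 : ¬(u3 = 0 ∧ u4 = 0))
    (n : Fin 4 → ℕ)
    (hn : n = ![a2 * (a3 * u4 + u3 * a4), a1 * (a3 * u4 + u3 * a4),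
      a4 * (a1 * u2 + u1 * a2), a3 * (a1 * u2 + u1 * a2)])
    (v : Fin 4 → ℕ)
    (hv : v = ![a3 * u4 + u3 * a4, a3 * u4 + u3 * a4,
      a4 * (u1 + u2), a3 * (u1 + u2)]) :
    ∀ w : ℕ, 0 < w →
      Nat.gcd (Nat.gcd (Nat.gcd (n 0 + w * v 0) (n 1 + w * v 1))
        (n 2 + w * v 2)) (n 3 + w * v 3) = 1 →
      toricIdeal K (fun j => n j + w * v j) =
        Ideal.span {(X 0 : MvPolynomial (Fin 4) K) ^ (a1 + w) - X 1 ^ (a2 + w),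
          X 2 ^ a3 - X 3 ^ a4,
          X 0 ^ u1 * X 1 ^ u2 - X 2 ^ u3 * X 3 ^ u4} ∧
      ∃ g1 g2 g3 : MvPolynomial (Fin 4) K,
        toricIdeal K (fun j => n j + w * v j) = Ideal.span {g1, g2, g3} := by
  intro w _ hgcd
  have hw : (fun j => n j + w * v j) =
      ![(a2 + w) * (a3 * u4 + u3 * a4), (a1 + w) * (a3 * u4 + u3 * a4),
        a4 * ((a1 + w) * u2 + u1 * (a2 + w)), a3 * ((a1 + w) * u2 + u1 * (a2 + w))] := by
    subst hn hv
    funext j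
    fin_cases j <;> simp <;> ring
  have hq : 0 < (a1 + w) * u2 + u1 * (a2 + w) := by
    rcases Nat.eq_zero_or_pos u1 with h | h
    · have : 0 < u2 := by omega
      positivity
    · positivity
  have key := toricIdeal_glued_eq_span K (a := a1 + w) (b := a2 + w) (c := a3) (d := a4)
    (u1 := u1) (u2 := u2) (u3 := u3) (u4 := u4) (by omega) ha3 hq rfl rfl (by
      rw [congrFun hw 0, congrFun hw 1, congrFun hw 2, congrFun hw 3] at hgcd
      exact hgcd)
  rw [← hw] at key
  exact ⟨key, _, _, _, key⟩
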